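/- arXiv:2401.01738 — 2 statements merged into one kernel-verified Lean document; each statement's English description precedes it below -/
import Mathlib

section
/- Spatial smoothing factorization (noiseless): Let X ∈ ℂ^{I₁×I₂×K} admit a CPD with factor matrices B⁽¹⁾ ∈ ℂ^{I₁×Q}, B⁽²⁾ ∈ ℂ^{I₂×Q}, B⁽³⁾ ∈ ℂ^{K×Q}, where B⁽³⁾ is Vandermonde with generators z₁,…,z_Q. Let K₃, L₃ be positive integers with K₃ + L₃ = K + 1, and define the spatially smoothed matrix Y_S ∈ ℂ^{K₃I₂ × L₃I₁} by [Y_S]_{(κ−1)I₂ + j, (ℓ−1)I₁ + i} = X_{i, j, ℓ+κ−1} for 1 ≤ κ ≤ K₃, 1 ≤ j ≤ I₂, 1 ≤ ℓ ≤ L₃, 1 ≤ i ≤ I₁. Then Y_S = (B⁽³⁾⁽ᴷ³⁾ ⊙ B⁽²⁾) (B⁽³⁾⁽ᴸ³⁾ ⊙ B⁽¹⁾)ᵀ. -/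
open Matrix

noncomputable section

/-- `X` admits a CPD with factor matrices `B1`, `B2`, `B3`. -/
def IsCPD {I₁ I₂ I₃ Q : ℕ} (X : Fin I₁ → Fin I₂ → Fin I₃ → ℂ)
    (B1 : Matrix (Fin I₁) (Fin Q) ℂ) (B2 : Matrix (Fin I₂) (Fin Q) ℂ)
    (B3 : Matrix (Fin I₃) (Fin Q) ℂ) : Prop :=
  ∀ i j k, X i j k = ∑ q, B1 i q * B2 j q * B3 k q

/-- `B` is a Vandermonde matrix with generators `z`: `B_{k,q} = z_q^{k-1}`
(with 1-based row index `k`, i.e. exponent `k` for the 0-based index). -/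
def IsVandermonde {K Q : ℕ} (B : Matrix (Fin K) (Fin Q) ℂ) (z : Fin Q → ℂ) : Prop :=
  ∀ k q, B k q = z q ^ (k : ℕ)

/-- The Khatri-Rao (columnwise Kronecker) product: the row indexed by `(i, j)`
corresponds to row `(i-1)J + j` in 1-based linear indexing. -/
def khatriRao {I J : Type*} {Q : ℕ} (A : Matrix I (Fin Q) ℂ)
    (B : Matrix J (Fin Q) ℂ) : Matrix (I × J) (Fin Q) ℂ :=
  Matrix.of fun p q => A p.1 q * B p.2 q

/-- The submatrix consisting of the first `m` rows of `A`. -/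
def firstRows {K Q : ℕ} (A : Matrix (Fin K) (Fin Q) ℂ) (m : ℕ) (h : m ≤ K) :
    Matrix (Fin m) (Fin Q) ℂ :=
  Matrix.of fun i q => A (Fin.castLE h i) q

/-- Spatial smoothing factorization (noiseless): the spatially smoothed matrix
`Y_S`, whose entry in row `(κ, j)` and column `(ℓ, i)` is `X_{i,j,ℓ+κ-1}`
(1-based), factors as `(B3^{(K₃)} ⊙ B2) (B3^{(L₃)} ⊙ B1)ᵀ`. -/
theorem spatial_smoothing_factorization {I₁ I₂ K Q : ℕ}
    (X : Fin I₁ → Fin I₂ → Fin K → ℂ)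
    (B1 : Matrix (Fin I₁) (Fin Q) ℂ) (B2 : Matrix (Fin I₂) (Fin Q) ℂ)
    (B3 : Matrix (Fin K) (Fin Q) ℂ)
    (hB : IsCPD X B1 B2 B3)
    (z : Fin Q → ℂ) (hV : IsVandermonde B3 z)
    (K₃ L₃ : ℕ) (hK₃ : 1 ≤ K₃) (hL₃ : 1 ≤ L₃) (hsum : K₃ + L₃ = K + 1) :
    (Matrix.of fun (p : Fin K₃ × Fin I₂) (c : Fin L₃ × Fin I₁) =>
        X c.2 p.2 ⟨p.1.1 + c.1.1, by
          have h1 := p.1.isLt; have h2 := c.1.isLt; omega⟩)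
      = khatriRao (firstRows B3 K₃ (by omega)) B2 *
        (khatriRao (firstRows B3 L₃ (by omega)) B1).transpose := by
  ext p c
  simp only [Matrix.of_apply, Matrix.mul_apply, Matrix.transpose_apply, khatriRao, firstRows,
    hB _ _ _, hV _ _, Fin.val_castLE, pow_add]
  exact Finset.sum_congr rfl fun q _ => by ring
end
end

section
/- ESPRIT-type recovery of Vandermonde generators: Let V ∈ ℂ^{K×Q} be Vandermonde with generators z₁,…,z_Q, let B ∈ ℂ^{N×Q}, and set E = V ⊙ B ∈ ℂ^{KN×Q}. Assume the submatrix E₁ ∈ ℂ^{(K−1)N×Q} consisting of the first (K−1)N rows of E has rank Q, and let E₂ consist of the last (K−1)N rows of E. Let M ∈ ℂ^{Q×Q} be invertible and set U = E M, with U₁, U₂ the corresponding first and last (K−1)N rows of U. Then U₁ has rank Q and U₁† U₂ = M⁻¹ diag(z₁,…,z_Q) M, where U₁† denotes the Moore-Penrose pseudoinverse; in particular the eigenvalues of U₁† U₂, counted with multiplicity, are exactly z₁,…,z_Q. -/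
open Matrix Polynomial

noncomputable section

/-- The Moore-Penrose pseudoinverse of a full-column-rank matrix:
`F† = (Fᴴ F)⁻¹ Fᴴ`. -/
def pinv {m n : Type*} [Fintype m] [Fintype n] [DecidableEq n]
    (F : Matrix m n ℂ) : Matrix n m ℂ :=
  (F.conjTranspose * F)⁻¹ * F.conjTranspose

/-- The submatrix of the first `(K-1)N` rows of a matrix indexed by
`Fin K × Fin N` (rows `(k, n)` with `k < K-1`). -/
def topRows {K N Q : ℕ} (E : Matrix (Fin K × Fin N) (Fin Q) ℂ) :
    Matrix (Fin (K - 1) × Fin N) (Fin Q) ℂ :=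
  Matrix.of fun p q =>
    E (⟨p.1.1, lt_of_lt_of_le p.1.isLt (Nat.sub_le K 1)⟩, p.2) q

/-- The submatrix of the last `(K-1)N` rows of a matrix indexed by
`Fin K × Fin N` (rows `(k+1, n)` with `k < K-1`). -/
def botRows {K N Q : ℕ} (E : Matrix (Fin K × Fin N) (Fin Q) ℂ) :
    Matrix (Fin (K - 1) × Fin N) (Fin Q) ℂ :=
  Matrix.of fun p q =>
    E (⟨p.1.1 + 1, Nat.add_lt_of_lt_sub p.1.isLt⟩, p.2) q

theorem topRows_mul {K N Q : ℕ} (E : Matrix (Fin K × Fin N) (Fin Q) ℂ)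
    (M : Matrix (Fin Q) (Fin Q) ℂ) : topRows (E * M) = topRows E * M := rfl

theorem botRows_mul {K N Q : ℕ} (E : Matrix (Fin K × Fin N) (Fin Q) ℂ)
    (M : Matrix (Fin Q) (Fin Q) ℂ) : botRows (E * M) = botRows E * M := rfl

/-- Shift invariance of the Khatri-Rao product with a Vandermonde left factor. -/
theorem botRows_khatriRao {K N Q : ℕ} {V : Matrix (Fin K) (Fin Q) ℂ} {z : Fin Q → ℂ}
    (hV : IsVandermonde V z) (B : Matrix (Fin N) (Fin Q) ℂ) :
    botRows (khatriRao V B) = topRows (khatriRao V B) * Matrix.diagonal z := by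
  ext p q
  simp only [Matrix.mul_diagonal, botRows, topRows, khatriRao, Matrix.of_apply, hV _ q]
  ring

open scoped ComplexOrder in
theorem pinv_mul_self {m n : Type*} [Fintype m] [Fintype n] [DecidableEq n]
    (F : Matrix m n ℂ) (hF : F.rank = Fintype.card n) : pinv F * F = 1 := by
  have hinj : Function.Injective F.mulVec := by
    rw [Matrix.mulVec_injective_iff, linearIndependent_iff_card_eq_finrank_span, ← hF,
      Matrix.rank_eq_finrank_span_cols]
    rfl
  have hu : IsUnit (F.conjTranspose * F) := by
    rw [← Matrix.mulVec_injective_iff_isUnit]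
    intro x y hxy
    apply hinj
    rw [← sub_eq_zero, ← Matrix.mulVec_sub] at hxy ⊢
    exact (Matrix.conjTranspose_mul_self_mulVec_eq_zero F _).mp hxy
  rw [pinv, Matrix.mul_assoc]
  exact Matrix.nonsing_inv_mul _ ((Matrix.isUnit_iff_isUnit_det _).mp hu)

/-- ESPRIT-type recovery of Vandermonde generators: if the top part `E₁` of
`E = V ⊙ B` has full column rank `Q` and `M` is invertible, then for
`U = E M`, the matrix `U₁` has rank `Q`, `U₁† U₂ = M⁻¹ diag(z) M`, and the
eigenvalues of `U₁† U₂` counted with multiplicity (i.e. the roots of its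
characteristic polynomial) are exactly `z₁, …, z_Q`. -/
theorem esprit_recovery {K N Q : ℕ}
    (V : Matrix (Fin K) (Fin Q) ℂ) (z : Fin Q → ℂ)
    (hV : IsVandermonde V z)
    (B : Matrix (Fin N) (Fin Q) ℂ)
    (hrank : (topRows (khatriRao V B)).rank = Q)
    (M : Matrix (Fin Q) (Fin Q) ℂ) (hM : IsUnit M) :
    (topRows (khatriRao V B * M)).rank = Q ∧
    pinv (topRows (khatriRao V B * M)) * botRows (khatriRao V B * M)
      = M⁻¹ * Matrix.diagonal z * M ∧
    (pinv (topRows (khatriRao V B * M)) * botRows (khatriRao V B * M)).charpoly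
      = ∏ q : Fin Q, (X - C (z q)) := by
  have hdet := (Matrix.isUnit_iff_isUnit_det M).mp hM
  have hU : (topRows (khatriRao V B * M)).rank = Q := by
    rw [topRows_mul, Matrix.rank_mul_eq_left_of_isUnit_det _ _ hdet, hrank]
  have hshift : botRows (khatriRao V B * M)
      = topRows (khatriRao V B * M) * (M⁻¹ * Matrix.diagonal z * M) := by
    rw [botRows_mul, topRows_mul, botRows_khatriRao hV]
    simp only [Matrix.mul_assoc, Matrix.mul_nonsing_inv_cancel_left _ _ hdet]
  have hmain : pinv (topRows (khatriRao V B * M)) * botRows (khatriRao V B * M)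
      = M⁻¹ * Matrix.diagonal z * M := by
    rw [hshift, ← Matrix.mul_assoc, pinv_mul_self _ (by simpa using hU), Matrix.one_mul]
  refine ⟨hU, hmain, ?_⟩
  rw [hmain, Matrix.mul_assoc, Matrix.charpoly_mul_comm, Matrix.mul_assoc,
    Matrix.mul_nonsing_inv _ hdet, Matrix.mul_one, Matrix.charpoly_diagonal]
end
end
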